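/- arXiv:math/0305123 — 2 statements merged into one kernel-verified Lean document; each statement's English description precedes it below -/
import Mathlib

section
/- For every real s with 0 < s < q^{2n} and every ρ ∈ ℝ, the series (1 − q^{2n}) Σ_{k=0}^{∞} s^k φ_ρ(q^{2k}) q^{−2nk} (q^{2k+2};q²)_{n−1} converges absolutely and equals (q²;q²)_n · (s;q²)_∞² / [(s q^{−n+iρ};q²)_∞ (s q^{−n−iρ};q²)_∞]. (With s = q^{2N}, N > n, this computes the q-spherical transform of the power function y^N on the quantum ball: 𝓕y^N = (q²;q²)_n (q^{2N};q²)_∞² / [(q^{2N−n+iρ};q²)_∞ (q^{2N−n−iρ};q²)_∞].) -/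
/-- The q²-shifted factorial `(a; q²)_m = ∏_{j=0}^{m-1} (1 − a q^{2j})`. -/
noncomputable def qpochC (q : ℝ) (a : ℂ) (m : ℕ) : ℂ :=
  ∏ j ∈ Finset.range m, (1 - a * (q : ℂ) ^ (2 * j))

/-- The infinite q²-shifted factorial `(a; q²)_∞`. -/
noncomputable def qpochCInf (q : ℝ) (a : ℂ) : ℂ :=
  ∏' j : ℕ, (1 - a * (q : ℂ) ^ (2 * j))

/-- `q^z = e^{z·ln q}` for complex `z`. -/
noncomputable def qcpow (q : ℝ) (z : ℂ) : ℂ := Complex.exp (z * Real.log q)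

/-- The q-spherical function `φ_ρ(q^{2m})`. -/
noncomputable def sphPhi (q : ℝ) (n : ℕ) (ρ : ℝ) (m : ℕ) : ℂ :=
  ∑ l ∈ Finset.range (m + 1),
    qpochC q (((q : ℂ) ^ (2 * m))⁻¹) l *
      qpochC q (qcpow q ((n : ℂ) + ρ * Complex.I)) l *
      qpochC q (qcpow q ((n : ℂ) - ρ * Complex.I)) l /
      (qpochC q ((q : ℂ) ^ (2 * n)) l * qpochC q ((q : ℂ) ^ 2) l) * (q : ℂ) ^ (2 * l)

open Filter Topology PowerSeries

lemma qpochC_zero (q : ℝ) (a : ℂ) : qpochC q a 0 = 1 := by simp [qpochC]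

lemma qpochC_succ (q : ℝ) (a : ℂ) (m : ℕ) :
    qpochC q a (m + 1) = qpochC q a m * (1 - a * (q : ℂ) ^ (2 * m)) := by
  simp [qpochC, Finset.prod_range_succ]

lemma qpochC_succ' (q : ℝ) (a : ℂ) (m : ℕ) :
    qpochC q a (m + 1) = (1 - a) * qpochC q (a * (q : ℂ) ^ 2) m := by
  simp only [qpochC, Finset.prod_range_succ']
  rw [mul_comm]
  congr 1
  · simp
  · refine Finset.prod_congr rfl fun j _ => ?_
    ring

lemma qpochC_add (q : ℝ) (a : ℂ) (m n : ℕ) :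
    qpochC q a (m + n) = qpochC q a m * qpochC q (a * (q : ℂ) ^ (2 * m)) n := by
  simp only [qpochC, Finset.prod_range_add]
  congr 1
  refine Finset.prod_congr rfl fun j _ => ?_
  ring

lemma one_sub_pow_ne_zero {q : ℝ} (hq0 : 0 < q) (hq1 : q < 1) {m : ℕ} (hm : m ≠ 0) :
    1 - (q : ℂ) ^ m ≠ 0 := by
  rw [sub_ne_zero]
  exact_mod_cast (pow_lt_one₀ hq0.le hq1 hm).ne'

lemma qpochC_pow_ne_zero {q : ℝ} (hq0 : 0 < q) (hq1 : q < 1) {r : ℕ} (hr : r ≠ 0) (m : ℕ) :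
    qpochC q ((q : ℂ) ^ r) m ≠ 0 := by
  refine Finset.prod_ne_zero_iff.mpr fun j _ => ?_
  rw [← pow_add]
  exact one_sub_pow_ne_zero hq0 hq1 (by omega)

lemma tendsto_qpochC {q : ℝ} (hq0 : 0 < q) (hq1 : q < 1) (a : ℂ) :
    Tendsto (qpochC q a) atTop (𝓝 (qpochCInf q a)) := by
  have hs : Summable fun j : ℕ => ‖-(a * (q : ℂ) ^ (2 * j))‖ := by
    have : Summable fun j : ℕ => ‖a‖ * (q ^ 2) ^ j :=
      (summable_geometric_of_lt_one (by positivity) (by nlinarith)).mul_left _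
    refine this.congr fun j => ?_
    simp [pow_mul, abs_of_pos hq0]
  have := (multipliable_one_add_of_summable hs).hasProd.tendsto_prod_nat
  simp only [← sub_eq_add_neg] at this
  exact this

/-- The coefficient `(b; q²)_j / (q²; q²)_j` of the `q`-binomial series. -/
noncomputable def qbinomCoeff (q : ℝ) (b : ℂ) (j : ℕ) : ℂ :=
  qpochC q b j / qpochC q ((q : ℂ) ^ 2) j

lemma qbinomCoeff_zero (q : ℝ) (b : ℂ) : qbinomCoeff q b 0 = 1 := by
  simp [qbinomCoeff, qpochC_zero]

lemma qbinomCoeff_succ {q : ℝ} (hq0 : 0 < q) (hq1 : q < 1) (b : ℂ) (j : ℕ) :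
    qbinomCoeff q b (j + 1) * (1 - (q : ℂ) ^ (2 * (j + 1))) =
      qbinomCoeff q b j * (1 - b * (q : ℂ) ^ (2 * j)) := by
  have h1 := qpochC_pow_ne_zero hq0 hq1 two_ne_zero j
  have h2 : 1 - (q : ℂ) ^ (2 * (j + 1)) ≠ 0 := one_sub_pow_ne_zero hq0 hq1 (by omega)
  rw [qbinomCoeff, qbinomCoeff, qpochC_succ, qpochC_succ, ← pow_add,
    show 2 + 2 * j = 2 * (j + 1) by ring]
  field_simp

lemma summable_qbinom {q : ℝ} (hq0 : 0 < q) (hq1 : q < 1) (b : ℂ) {z : ℂ} (hz : ‖z‖ < 1) :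
    Summable fun j => ‖qbinomCoeff q b j * z ^ j‖ := by
  have hpow : Tendsto (fun j : ℕ => (q : ℂ) ^ (2 * j)) atTop (𝓝 0) := by
    simp only [pow_mul]
    refine tendsto_pow_atTop_nhds_zero_of_norm_lt_one ?_
    rw [norm_pow, Complex.norm_real, Real.norm_of_nonneg hq0.le]
    nlinarith
  have hratio : Tendsto (fun j : ℕ => ‖(1 - b * (q : ℂ) ^ (2 * j)) /
      (1 - (q : ℂ) ^ (2 * (j + 1))) * z‖) atTop (𝓝 ‖z‖) := by
    have h1 := (hpow.const_mul b).const_sub 1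
    have h2 := ((tendsto_add_atTop_iff_nat 1).2 hpow).const_sub 1
    have := ((h1.div h2 (by simp)).mul_const z).norm
    simpa using this
  obtain ⟨r, hr, hr1⟩ := exists_between hz
  refine summable_of_ratio_norm_eventually_le hr1 ?_
  filter_upwards [hratio.eventually_le_const hr] with j hj
  have h2 : 1 - (q : ℂ) ^ (2 * (j + 1)) ≠ 0 := one_sub_pow_ne_zero hq0 hq1 (by omega)
  have : qbinomCoeff q b (j + 1) * z ^ (j + 1) =
      ((1 - b * (q : ℂ) ^ (2 * j)) / (1 - (q : ℂ) ^ (2 * (j + 1))) * z) *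
        (qbinomCoeff q b j * z ^ j) := by
    have h := qbinomCoeff_succ hq0 hq1 b j
    field_simp
    linear_combination z ^ (j + 1) * h
  rw [norm_norm, norm_norm, this, norm_mul _ (qbinomCoeff q b j * z ^ j)]
  gcongr

lemma qbinom_functional_eq {q : ℝ} (hq0 : 0 < q) (hq1 : q < 1) (b : ℂ) {z : ℂ} (hz : ‖z‖ < 1) :
    (1 - z) * ∑' j, qbinomCoeff q b j * z ^ j =
      (1 - b * z) * ∑' j, qbinomCoeff q b j * (z * (q : ℂ) ^ 2) ^ j := by
  have hz' : ‖z * (q : ℂ) ^ 2‖ < 1 := by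
    rw [norm_mul, norm_pow, Complex.norm_real, Real.norm_of_nonneg hq0.le]
    nlinarith [norm_nonneg z]
  have s1 := (summable_qbinom hq0 hq1 b hz).of_norm
  have s2 := (summable_qbinom hq0 hq1 b hz').of_norm
  have e1 : ∑' j, qbinomCoeff q b j * z ^ j - ∑' j, qbinomCoeff q b j * (z * (q : ℂ) ^ 2) ^ j =
      z * ∑' j, qbinomCoeff q b j * z ^ j -
        b * z * ∑' j, qbinomCoeff q b j * (z * (q : ℂ) ^ 2) ^ j := by
    rw [← s1.tsum_sub s2, (s1.sub s2).tsum_eq_zero_add, ← tsum_mul_left, ← tsum_mul_left,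
      ← (s1.mul_left z).tsum_sub (s2.mul_left (b * z))]
    simp only [pow_zero, sub_self, zero_add]
    refine tsum_congr fun j => ?_
    have h := qbinomCoeff_succ hq0 hq1 b j
    rw [mul_pow, mul_pow, ← pow_mul, ← pow_mul]
    linear_combination z ^ (j + 1) * h
  linear_combination e1

/-- The `q`-binomial theorem, in denominator-free form. -/
lemma qbinom_mul {q : ℝ} (hq0 : 0 < q) (hq1 : q < 1) (b : ℂ) {z : ℂ} (hz : ‖z‖ < 1) :
    qpochCInf q z * ∑' j, qbinomCoeff q b j * z ^ j = qpochCInf q (b * z) := by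
  have hq2 : ‖(q : ℂ) ^ 2‖ < 1 := by
    rw [norm_pow, Complex.norm_real, Real.norm_of_nonneg hq0.le]
    nlinarith
  have hle (N : ℕ) : ‖z * (q : ℂ) ^ (2 * N)‖ ≤ ‖z‖ := by
    rw [norm_mul, pow_mul, norm_pow]
    exact mul_le_of_le_one_right (norm_nonneg _) (pow_le_one₀ (norm_nonneg _) hq2.le)
  have hiter (N : ℕ) : qpochC q z N * ∑' j, qbinomCoeff q b j * z ^ j =
      qpochC q (b * z) N * ∑' j, qbinomCoeff q b j * (z * (q : ℂ) ^ (2 * N)) ^ j := by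
    induction N with
    | zero => simp [qpochC_zero]
    | succ N ih =>
      have h := qbinom_functional_eq hq0 hq1 b ((hle N).trans_lt hz)
      rw [mul_assoc z, ← pow_add, show 2 * N + 2 = 2 * (N + 1) by ring] at h
      rw [qpochC_succ, qpochC_succ]
      linear_combination (1 - z * (q : ℂ) ^ (2 * N)) * ih + qpochC q (b * z) N * h
  have hlim : Tendsto (fun N : ℕ => ∑' j, qbinomCoeff q b j * (z * (q : ℂ) ^ (2 * N)) ^ j) atTop
      (𝓝 (∑' j, qbinomCoeff q b j * 0 ^ j)) := by
    refine tendsto_tsum_of_dominated_convergence (summable_qbinom hq0 hq1 b hz) (fun j => ?_)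
      (Eventually.of_forall fun N j => ?_)
    · have h0 : Tendsto (fun N : ℕ => z * (q : ℂ) ^ (2 * N)) atTop (𝓝 0) := by
        simpa [pow_mul] using (tendsto_pow_atTop_nhds_zero_of_norm_lt_one hq2).const_mul z
      exact (h0.pow j).const_mul _
    · rw [norm_mul, norm_mul, norm_pow, norm_pow]
      gcongr
      exact hle N
  have hone : ∑' j, qbinomCoeff q b j * 0 ^ j = 1 := by
    rw [tsum_eq_single 0 fun j hj => by simp [hj]]
    simp [qbinomCoeff_zero]
  rw [hone] at hlim
  have h1 := (tendsto_qpochC hq0 hq1 z).mul_const (∑' j, qbinomCoeff q b j * z ^ j)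
  have h2 := (tendsto_qpochC hq0 hq1 (b * z)).mul hlim
  simp only [← hiter, mul_one] at h2
  exact tendsto_nhds_unique h1 h2

lemma qpochCInf_ne_zero {q : ℝ} (hq0 : 0 < q) (hq1 : q < 1) {z : ℂ} (hz : ‖z‖ < 1) :
    qpochCInf q z ≠ 0 := by
  have h := qbinom_mul hq0 hq1 0 hz
  refine left_ne_zero_of_mul (b := ∑' j, qbinomCoeff q 0 j * z ^ j) ?_
  rw [h]
  simp [qpochCInf]

/-- The `q`-binomial series `∑ (b; q²)_j / (q²; q²)_j (a X)^j` as a formal power series. -/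
noncomputable def qbinomSeries (q : ℝ) (b a : ℂ) : ℂ⟦X⟧ :=
  PowerSeries.mk fun j => qbinomCoeff q b j * a ^ j

lemma qbinomSeries_functional_eq {q : ℝ} (hq0 : 0 < q) (hq1 : q < 1) (b a : ℂ) :
    (1 - C a * X) * qbinomSeries q b a =
      (1 - C (a * b) * X) * rescale ((q : ℂ) ^ 2) (qbinomSeries q b a) := by
  ext k
  rcases k with _ | k
  · simp only [sub_mul, one_mul, mul_assoc, map_sub, coeff_C_mul, coeff_zero_X_mul, coeff_rescale,
      mul_zero, pow_zero]
  · simp only [sub_mul, one_mul, mul_assoc, map_sub, coeff_C_mul, coeff_succ_X_mul,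
      coeff_rescale, qbinomSeries, coeff_mk]
    have h := qbinomCoeff_succ hq0 hq1 b k
    rw [← pow_mul, ← pow_mul]
    linear_combination a ^ (k + 1) * h

/-- The three-term recurrence satisfied by the Al-Salam–Chihara coefficients. -/
structure IsASCRec (q : ℝ) (A B : ℂ) (f : ℕ → ℂ) : Prop where
  zero : f 0 = 1
  one : f 1 * (1 - (q : ℂ) ^ 2) = (A + B - 2 * (A * B)) * f 0
  add_two : ∀ k, f (k + 2) * (1 - (q : ℂ) ^ (2 * (k + 2))) =
    (A + B - 2 * (A * B) * (q : ℂ) ^ (2 * (k + 1))) * f (k + 1) -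
      A * B * (1 - A * B * (q : ℂ) ^ (2 * k)) * f k

lemma IsASCRec.unique {q : ℝ} (hq0 : 0 < q) (hq1 : q < 1) {A B : ℂ} {f g : ℕ → ℂ}
    (hf : IsASCRec q A B f) (hg : IsASCRec q A B g) : f = g := by
  have key (k : ℕ) : f k = g k ∧ f (k + 1) = g (k + 1) := by
    induction k with
    | zero =>
      have h0 : f 0 = g 0 := hf.zero.trans hg.zero.symm
      refine ⟨h0, mul_right_cancel₀ (one_sub_pow_ne_zero hq0 hq1 two_ne_zero) ?_⟩
      rw [zero_add, hf.one, hg.one, h0]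
    | succ k ih =>
      refine ⟨ih.2, mul_right_cancel₀
        (one_sub_pow_ne_zero hq0 hq1 (m := 2 * (k + 2)) (by omega)) ?_⟩
      rw [hf.add_two, hg.add_two, ih.1, ih.2]
  exact funext fun k => (key k).1

lemma isASCRec_qbinomSeries_mul {q : ℝ} (hq0 : 0 < q) (hq1 : q < 1) (A B : ℂ) :
    IsASCRec q A B fun k => coeff k (qbinomSeries q B A * qbinomSeries q A B) := by
  set F := qbinomSeries q B A * qbinomSeries q A B with hF
  have hFE : F - C A * (X * F) - C B * (X * F) + C (A * B) * (X * (X * F)) =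
      rescale ((q : ℂ) ^ 2) F - C (2 * (A * B)) * (X * rescale ((q : ℂ) ^ 2) F) +
        C (A * B * (A * B)) * (X * (X * rescale ((q : ℂ) ^ 2) F)) := by
    have h1 := qbinomSeries_functional_eq hq0 hq1 B A
    have h2 := qbinomSeries_functional_eq hq0 hq1 A B
    have h := congrArg₂ (· * ·) h1 h2
    simp only [map_mul, map_ofNat, hF] at h ⊢
    linear_combination h
  refine ⟨?_, ?_, fun k => ?_⟩
  · simp [hF, qbinomSeries, qbinomCoeff_zero]
  · have h := congrArg (coeff (0 + 1)) hFE
    simp only [map_sub, map_add, coeff_C_mul, coeff_succ_X_mul, coeff_rescale,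
      coeff_zero_X_mul, zero_add, pow_one, pow_zero, one_mul, mul_zero, add_zero] at h
    linear_combination h
  · have h := congrArg (coeff (k + 2)) hFE
    simp only [map_sub, map_add, coeff_C_mul, coeff_succ_X_mul, coeff_rescale,
      show k + 2 = k + 1 + 1 from rfl] at h
    simp only [← pow_mul] at h
    linear_combination h

/-- The coefficient of `(x; q²)_l` in the spherical function. -/
noncomputable def sphCoeff (q : ℝ) (A B : ℂ) (l : ℕ) : ℂ :=
  qpochC q A l * qpochC q B l / (qpochC q (A * B) l * qpochC q ((q : ℂ) ^ 2) l) * (q : ℂ) ^ (2 * l)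

lemma sphCoeff_succ {q : ℝ} (hq0 : 0 < q) (hq1 : q < 1) {A B : ℂ}
    (hAB : ∀ l, 1 - A * B * (q : ℂ) ^ (2 * l) ≠ 0) (l : ℕ) :
    sphCoeff q A B (l + 1) * ((1 - A * B * (q : ℂ) ^ (2 * l)) * (1 - (q : ℂ) ^ (2 * (l + 1)))) =
      sphCoeff q A B l * ((1 - A * (q : ℂ) ^ (2 * l)) * (1 - B * (q : ℂ) ^ (2 * l))) *
        (q : ℂ) ^ 2 := by
  have h1 := qpochC_pow_ne_zero hq0 hq1 two_ne_zero l
  have h2 : 1 - (q : ℂ) ^ (2 * (l + 1)) ≠ 0 := one_sub_pow_ne_zero hq0 hq1 (by omega)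
  have h3 : qpochC q (A * B) l ≠ 0 := Finset.prod_ne_zero_iff.mpr fun j _ => hAB j
  have h4 := hAB l
  simp only [sphCoeff, qpochC_succ]
  rw [← pow_add, show 2 + 2 * l = 2 * (l + 1) by ring]
  generalize 1 - A * B * (q : ℂ) ^ (2 * l) = D at h4 ⊢
  field_simp
  ring

/-- Truncated second-order `q`-difference equation: with `x = q² y`, the difference operator
applied to the partial sum telescopes to a single boundary term. -/
lemma sphCoeff_sum_diff {q : ℝ} (hq0 : 0 < q) (hq1 : q < 1) {A B : ℂ}
    (hAB : ∀ l, 1 - A * B * (q : ℂ) ^ (2 * l) ≠ 0) (y : ℂ) (M : ℕ) :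
    (q : ℂ) ^ (2 * M) * ∑ l ∈ Finset.range (M + 1), sphCoeff q A B l *
      ((q ^ 2 * y - A * B) * (qpochC q y l - qpochC q (q ^ 2 * y) l) -
        A * B * (1 - q ^ 2 * y) * (qpochC q (q ^ 2 * (q ^ 2 * y)) l - qpochC q (q ^ 2 * y) l) +
        (1 - A) * (1 - B) * (q ^ 2 * y) * qpochC q (q ^ 2 * y) l) =
      sphCoeff q A B M * ((1 - A * (q : ℂ) ^ (2 * M)) * (1 - B * (q : ℂ) ^ (2 * M))) *
        (q ^ 2 * y) * qpochC q (q ^ 2 * y) M := by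
  induction M with
  | zero => simp [qpochC_zero]; ring
  | succ M ih =>
    have hy : qpochC q y (M + 1) = (1 - y) * qpochC q (q ^ 2 * y) M := by
      rw [qpochC_succ', mul_comm y]
    have hx : (1 - q ^ 2 * y) * qpochC q (q ^ 2 * (q ^ 2 * y)) (M + 1) =
        qpochC q (q ^ 2 * y) M * (1 - q ^ 2 * y * q ^ (2 * M)) *
          (1 - q ^ 2 * y * q ^ (2 * (M + 1))) := by
      rw [← qpochC_succ, ← qpochC_succ, qpochC_succ' _ _ (M + 1), mul_comm (q ^ 2 : ℂ) (q ^ 2 * y)]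
    have hc := sphCoeff_succ hq0 hq1 hAB M
    rw [Finset.sum_range_succ, mul_add, show 2 * (M + 1) = 2 * M + 2 by ring, pow_add,
      mul_right_comm ((q : ℂ) ^ (2 * M)), ih]
    rw [show 2 * (M + 1) = 2 * M + 2 by ring, pow_add] at hc hx
    rw [qpochC_succ q (q ^ 2 * y) M, hy]
    linear_combination -((q : ℂ) ^ 2 * y * qpochC q (q ^ 2 * y) M) * hc -
      (q : ℂ) ^ (2 * M) * q ^ 2 * sphCoeff q A B (M + 1) * (A * B) * hx


/-- The terminating `₃φ₂` series at `q^{2k}`, with general parameters `A`, `B`. -/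
noncomputable def sphSeries (q : ℝ) (A B : ℂ) (k : ℕ) : ℂ :=
  ∑ l ∈ Finset.range (k + 1), sphCoeff q A B l * qpochC q (((q : ℂ) ^ (2 * k))⁻¹) l

lemma qpochC_inv_pow_eq_zero {q : ℝ} (hq0 : 0 < q) {k l : ℕ} (h : k < l) :
    qpochC q (((q : ℂ) ^ (2 * k))⁻¹) l = 0 := by
  refine Finset.prod_eq_zero (Finset.mem_range.mpr h) ?_
  rw [inv_mul_cancel₀ (pow_ne_zero _ (by exact_mod_cast hq0.ne')), sub_self]

lemma sphSeries_eq_sum {q : ℝ} (hq0 : 0 < q) (A B : ℂ) {k M : ℕ} (h : k < M) :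
    ∑ l ∈ Finset.range M, sphCoeff q A B l * qpochC q (((q : ℂ) ^ (2 * k))⁻¹) l =
      sphSeries q A B k := by
  refine (Finset.sum_subset (Finset.range_subset_range.mpr h) fun l _ hl => ?_).symm
  rw [qpochC_inv_pow_eq_zero hq0 (by simpa using hl), mul_zero]

lemma sphSeries_recurrence {q : ℝ} (hq0 : 0 < q) (hq1 : q < 1) {A B : ℂ}
    (hAB : ∀ l, 1 - A * B * (q : ℂ) ^ (2 * l) ≠ 0) (k : ℕ) :
    (1 - A * B * (q : ℂ) ^ (2 * (k + 1))) *
        (sphSeries q A B (k + 2) - sphSeries q A B (k + 1)) +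
      A * B * (1 - (q : ℂ) ^ (2 * (k + 1))) * (sphSeries q A B k - sphSeries q A B (k + 1)) +
      (1 - A) * (1 - B) * sphSeries q A B (k + 1) = 0 := by
  have hq : (q : ℂ) ≠ 0 := by exact_mod_cast hq0.ne'
  have hx : (q : ℂ) ^ 2 * ((q : ℂ) ^ (2 * (k + 2)))⁻¹ = ((q : ℂ) ^ (2 * (k + 1)))⁻¹ := by
    field_simp
    ring
  have hx' : (q : ℂ) ^ 2 * ((q : ℂ) ^ (2 * (k + 1)))⁻¹ = ((q : ℂ) ^ (2 * k))⁻¹ := by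
    field_simp
    ring
  have h := sphCoeff_sum_diff hq0 hq1 hAB ((q : ℂ) ^ (2 * (k + 2)))⁻¹ (k + 2)
  rw [hx, hx', qpochC_inv_pow_eq_zero hq0 (by omega : k + 1 < k + 2), mul_zero] at h
  have h' := (mul_eq_zero.mp h).resolve_left (pow_ne_zero _ hq)
  rw [← sphSeries_eq_sum hq0 A B (by omega : k < k + 2 + 1),
    ← sphSeries_eq_sum hq0 A B (by omega : k + 1 < k + 2 + 1),
    ← sphSeries_eq_sum hq0 A B (by omega : k + 2 < k + 2 + 1)]
  have hP : (q : ℂ) ^ (2 * (k + 1)) * ((q : ℂ) ^ (2 * (k + 1)))⁻¹ = 1 :=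
    mul_inv_cancel₀ (pow_ne_zero _ hq)
  rw [← mul_zero ((q : ℂ) ^ (2 * (k + 1))), ← h', Finset.mul_sum]
  simp only [← Finset.sum_sub_distrib, Finset.mul_sum, ← Finset.sum_add_distrib]
  refine Finset.sum_congr rfl fun l _ => ?_
  generalize ((q : ℂ) ^ (2 * (k + 1)))⁻¹ = x at hP ⊢
  generalize (q : ℂ) ^ (2 * (k + 1)) = P at hP ⊢
  generalize qpochC q ((q : ℂ) ^ (2 * k))⁻¹ l = u
  generalize qpochC q ((q : ℂ) ^ (2 * (k + 2)))⁻¹ l = v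
  linear_combination (-sphCoeff q A B l * ((v - qpochC q x l) + A * B * (u - qpochC q x l) +
    (1 - A) * (1 - B) * qpochC q x l)) * hP

lemma isASCRec_sphSeries {q : ℝ} (hq0 : 0 < q) (hq1 : q < 1) {A B : ℂ}
    (hAB : ∀ l, 1 - A * B * (q : ℂ) ^ (2 * l) ≠ 0) :
    IsASCRec q A B fun k => qbinomCoeff q (A * B) k * sphSeries q A B k := by
  have hq : (q : ℂ) ≠ 0 := by exact_mod_cast hq0.ne'
  refine ⟨?_, ?_, fun k => ?_⟩
  · simp [qbinomCoeff_zero, sphSeries, sphCoeff, qpochC_zero]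
  · have h1 := qbinomCoeff_succ hq0 hq1 (A * B) 0
    have h2 := sphCoeff_succ hq0 hq1 hAB 0
    have h3 : 1 - (q : ℂ) ^ 2 ≠ 0 := one_sub_pow_ne_zero hq0 hq1 two_ne_zero
    have h0 : sphCoeff q A B 0 = 1 := by simp [sphCoeff, qpochC_zero]
    simp only [h0, qbinomCoeff_zero, zero_add, mul_zero, pow_zero, mul_one, one_mul] at h1 h2
    have hinv : (q : ℂ) ^ 2 * ((q : ℂ) ^ 2)⁻¹ = 1 := mul_inv_cancel₀ (pow_ne_zero _ hq)
    simp only [sphSeries, Finset.sum_range_succ, Finset.sum_range_zero, qpochC_succ, qpochC_zero,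
      h0, qbinomCoeff_zero, zero_add, mul_zero, pow_zero, mul_one, one_mul]
    have h4 : sphCoeff q A B 1 * (1 - A * B) * (1 - ((q : ℂ) ^ 2)⁻¹) = -((1 - A) * (1 - B)) := by
      refine mul_right_cancel₀ h3 ?_
      linear_combination (1 - ((q : ℂ) ^ 2)⁻¹) * h2 + (1 - A) * (1 - B) * (-hinv)
    linear_combination (1 + sphCoeff q A B 1 * (1 - ((q : ℂ) ^ 2)⁻¹)) * h1 + h4
  · have h0 := qbinomCoeff_succ hq0 hq1 (A * B) k
    have h1 := qbinomCoeff_succ hq0 hq1 (A * B) (k + 1)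
    have h := sphSeries_recurrence hq0 hq1 hAB k
    linear_combination sphSeries q A B (k + 2) * h1 - A * B * sphSeries q A B k * h0 +
      qbinomCoeff q (A * B) (k + 1) * h

lemma sphSeries_eq_sum_antidiagonal {q : ℝ} (hq0 : 0 < q) (hq1 : q < 1) {A B : ℂ}
    (hAB : ∀ l, 1 - A * B * (q : ℂ) ^ (2 * l) ≠ 0) (u : ℂ) (k : ℕ) :
    qbinomCoeff q (A * B) k * sphSeries q A B k * u ^ k =
      ∑ ij ∈ Finset.HasAntidiagonal.antidiagonal k, (qbinomCoeff q B ij.1 * (A * u) ^ ij.1) *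
        (qbinomCoeff q A ij.2 * (B * u) ^ ij.2) := by
  have h := congrFun ((isASCRec_sphSeries hq0 hq1 hAB).unique hq0 hq1
    (isASCRec_qbinomSeries_mul hq0 hq1 A B)) k
  simp only [coeff_mul, qbinomSeries, coeff_mk] at h
  rw [h, Finset.sum_mul]
  refine Finset.sum_congr rfl fun ij hij => ?_
  rw [← Finset.HasAntidiagonal.mem_antidiagonal.mp hij]
  ring

/-- Generating function of `sphSeries`, obtained as a Cauchy product of `q`-binomial series. -/
lemma sphSeries_generating {q : ℝ} (hq0 : 0 < q) (hq1 : q < 1) {A B u : ℂ}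
    (hAB : ∀ l, 1 - A * B * (q : ℂ) ^ (2 * l) ≠ 0) (hA : ‖A * u‖ < 1) (hB : ‖B * u‖ < 1) :
    (Summable fun k => ‖qbinomCoeff q (A * B) k * sphSeries q A B k * u ^ k‖) ∧
      ∑' k, qbinomCoeff q (A * B) k * sphSeries q A B k * u ^ k =
        qpochCInf q (A * B * u) ^ 2 / (qpochCInf q (A * u) * qpochCInf q (B * u)) := by
  have hs1 := summable_qbinom hq0 hq1 B hA
  have hs2 := summable_qbinom hq0 hq1 A hB
  have hterm := sphSeries_eq_sum_antidiagonal hq0 hq1 hAB u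
  have h1 := qbinom_mul hq0 hq1 B hA
  have h2 := qbinom_mul hq0 hq1 A hB
  rw [mul_left_comm, ← mul_assoc] at h1
  rw [← mul_assoc] at h2
  have hprod := tsum_mul_tsum_eq_tsum_sum_antidiagonal_of_summable_norm hs1 hs2
  refine ⟨(summable_norm_sum_mul_antidiagonal_of_summable_norm hs1 hs2).congr fun k =>
    congrArg norm (hterm k).symm, ?_⟩
  rw [eq_div_iff (mul_ne_zero (qpochCInf_ne_zero hq0 hq1 hA) (qpochCInf_ne_zero hq0 hq1 hB)),
    tsum_congr hterm, ← hprod]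
  linear_combination (qpochCInf q (B * u) * ∑' j, qbinomCoeff q A j * (B * u) ^ j) * h1 +
    qpochCInf q (A * B * u) * h2

lemma qcpow_add (q : ℝ) (z w : ℂ) : qcpow q (z + w) = qcpow q z * qcpow q w := by
  rw [qcpow, add_mul, Complex.exp_add, qcpow, qcpow]

lemma qcpow_natCast {q : ℝ} (hq0 : 0 < q) (m : ℕ) : qcpow q m = (q : ℂ) ^ m := by
  rw [qcpow, Complex.exp_nat_mul, ← Complex.ofReal_exp, Real.exp_log hq0]

lemma norm_qcpow {q : ℝ} (hq0 : 0 < q) (n : ℕ) (ρ : ℝ) :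
    ‖qcpow q ((n : ℂ) + ρ * Complex.I)‖ = q ^ n := by
  rw [qcpow_add, qcpow_natCast hq0, norm_mul, qcpow, mul_right_comm, ← Complex.ofReal_mul,
    Complex.norm_exp_ofReal_mul_I, mul_one, norm_pow, Complex.norm_real,
    Real.norm_of_nonneg hq0.le]

/-- For `0 < s < q^{2n}`, the series `(1 − q^{2n}) Σ_k s^k φ_ρ(q^{2k}) q^{−2nk}
(q^{2k+2};q²)_{n−1}` converges absolutely and equals
`(q²;q²)_n (s;q²)_∞² / [(sq^{−n+iρ};q²)_∞ (sq^{−n−iρ};q²)_∞]`. -/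
theorem statement14 (q : ℝ) (hq0 : 0 < q) (hq1 : q < 1) (n : ℕ) (hn : 1 ≤ n)
    (s : ℝ) (hs0 : 0 < s) (hs : s < q ^ (2 * n)) (ρ : ℝ) :
    Summable (fun k : ℕ => ‖(s : ℂ) ^ k * sphPhi q n ρ k * ((q : ℂ) ^ (2 * n * k))⁻¹ *
      qpochC q ((q : ℂ) ^ (2 * k + 2)) (n - 1)‖) ∧
    (1 - (q : ℂ) ^ (2 * n)) *
      ∑' k : ℕ, (s : ℂ) ^ k * sphPhi q n ρ k * ((q : ℂ) ^ (2 * n * k))⁻¹ *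
        qpochC q ((q : ℂ) ^ (2 * k + 2)) (n - 1) =
    qpochC q ((q : ℂ) ^ 2) n * (qpochCInf q (s : ℂ)) ^ 2 /
      (qpochCInf q ((s : ℂ) * qcpow q (-(n : ℂ) + ρ * Complex.I)) *
        qpochCInf q ((s : ℂ) * qcpow q (-(n : ℂ) - ρ * Complex.I))) := by
  obtain ⟨m, rfl⟩ : ∃ m, n = m + 1 := ⟨n - 1, by omega⟩
  have hq : (q : ℂ) ≠ 0 := by exact_mod_cast hq0.ne'
  set n := m + 1 with hn'
  set A := qcpow q ((n : ℂ) + ρ * Complex.I) with hA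
  set B := qcpow q ((n : ℂ) - ρ * Complex.I) with hB
  set u : ℂ := s / (q : ℂ) ^ (2 * n) with hu
  have hAB : A * B = (q : ℂ) ^ (2 * n) := by
    rw [hA, hB, ← qcpow_add, ← qcpow_natCast hq0]
    congr 1
    push_cast
    ring
  have hABl (l : ℕ) : 1 - A * B * (q : ℂ) ^ (2 * l) ≠ 0 := by
    rw [hAB, ← pow_add]
    exact one_sub_pow_ne_zero hq0 hq1 (by omega)
  have hs' : (q : ℂ) ^ (2 * n) * u = s := mul_div_cancel₀ _ (pow_ne_zero _ hq)
  have hshift (z : ℂ) : s * qcpow q (-(n : ℂ) + z) = qcpow q ((n : ℂ) + z) * u := by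
    have : (n : ℂ) + z = ((2 * n : ℕ) : ℂ) + (-(n : ℂ) + z) := by push_cast; ring
    rw [this, qcpow_add q ((2 * n : ℕ) : ℂ), qcpow_natCast hq0, ← hs']
    ring
  have hunorm : ‖u‖ < 1 := by
    rw [hu, norm_div, norm_pow, Complex.norm_real, Complex.norm_real,
      Real.norm_of_nonneg hq0.le, Real.norm_of_nonneg hs0.le]
    exact (div_lt_one (by positivity)).mpr hs
  have hsmall (r : ℝ) : ‖qcpow q ((n : ℂ) + r * Complex.I) * u‖ < 1 := by
    rw [norm_mul, norm_qcpow hq0]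
    exact mul_lt_one_of_nonneg_of_lt_one_right (pow_le_one₀ hq0.le hq1.le) (norm_nonneg _) hunorm
  have hBr : B = qcpow q ((n : ℂ) + (-ρ : ℝ) * Complex.I) := by
    rw [hB]
    congr 1
    push_cast
    ring
  have hAu : ‖A * u‖ < 1 := hsmall ρ
  have hBu : ‖B * u‖ < 1 := hBr ▸ hsmall (-ρ)
  obtain ⟨hsum, htsum⟩ := sphSeries_generating hq0 hq1 hABl hAu hBu
  have hphi (k : ℕ) : sphPhi q n ρ k = sphSeries q A B k := by
    refine Finset.sum_congr rfl fun l _ => ?_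
    rw [sphCoeff, hAB]
    ring
  have hterm (k : ℕ) : (s : ℂ) ^ k * sphPhi q n ρ k * ((q : ℂ) ^ (2 * n * k))⁻¹ *
      qpochC q ((q : ℂ) ^ (2 * k + 2)) (n - 1) =
      qpochC q ((q : ℂ) ^ 2) m * (qbinomCoeff q (A * B) k * sphSeries q A B k * u ^ k) := by
    have h1 := qpochC_add q ((q : ℂ) ^ 2) k m
    have h2 := qpochC_add q ((q : ℂ) ^ 2) m k
    rw [← pow_add] at h1 h2
    rw [add_comm m k, h1, show 2 + 2 * m = 2 * n by omega, add_comm 2] at h2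
    have h3 := qpochC_pow_ne_zero hq0 hq1 two_ne_zero k
    rw [hphi, hAB, hu, div_pow, ← pow_mul, qbinomCoeff, show n - 1 = m by omega]
    field_simp
    linear_combination (s : ℂ) ^ k * sphSeries q A B k * h2
  simp only [hterm]
  refine ⟨by simpa only [norm_mul] using hsum.mul_left ‖qpochC q ((q : ℂ) ^ 2) m‖, ?_⟩
  rw [tsum_mul_left, htsum, hAB, hs', hshift, sub_eq_add_neg _ ((ρ : ℂ) * Complex.I), hshift,
    ← sub_eq_add_neg, hn', qpochC_succ, ← pow_add, show 2 + 2 * m = 2 * (m + 1) by ring]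
  ring
end

section
/- Let V be the complex vector space with basis {e_m : m ∈ ℤ_{≥0}^n}, and fix t = q^{2α} ∈ (0,1). Define linear operators on V by ẑ_i e_m = q^{m_{i+1}+…+m_n} e_{m+ε_i} and ẑ*_i e_m = q^{m_{i+1}+…+m_n} (1 − q^{2m_i})/(1 − t q^{2|m|+2n}) e_{m−ε_i} (interpreted as 0 when m_i = 0), where ε_i is the i-th standard basis multi-index and |m| = m_1+…+m_n. Then these operators satisfy: (i) ẑ_i ẑ_j = q ẑ_j ẑ_i for i < j; (ii) for i ≠ j, ẑ*_i ẑ_j = q ẑ_j ẑ*_i + t q^{2n} ( ẑ*_i ẑ_j (q² + (1−q²) Σ_{k=1}^{n} ẑ_k ẑ*_k) − q ẑ_j ẑ*_i ); and (iii) for each j, ẑ*_j ẑ_j = q² ẑ_j ẑ*_j + (1−q²)(1 − Σ_{k=j+1}^{n} ẑ_k ẑ*_k) + t q^{2n} ( ẑ*_j ẑ_j (q² + (1−q²) Σ_{k=1}^{n} ẑ_k ẑ*_k) − q² ẑ_j ẑ*_j − (1−q²) Σ_{k=1}^{j} ẑ_k ẑ*_k ) (Proposition 3.5, the defining relations of the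 two-parameter deformed polynomial algebra of Toeplitz operators). -/
open Finset in
theorem sum_filter_lt_add_single {n : ℕ} (m : Fin n → ℕ) (i j : Fin n) :
    ∑ k ∈ univ.filter (fun k => i < k), (m + Pi.single j 1 : Fin n → ℕ) k =
      ∑ k ∈ univ.filter (fun k => i < k), m k + if i < j then 1 else 0 := by
  simp [sum_add_distrib]

open Finset in
theorem sum_add_single {n : ℕ} (m : Fin n → ℕ) (j : Fin n) :
    ∑ k, (m + Pi.single j 1 : Fin n → ℕ) k = ∑ k, m k + 1 := by
  simp [sum_add_distrib]

open Finset in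
theorem sum_pow_mul_one_sub_pow {R ι : Type*} [CommRing R] [LinearOrder ι] (x : R) (m : ι → ℕ)
    (s : Finset ι) :
    ∑ k ∈ s, x ^ (∑ j ∈ s.filter (fun j => k < j), m j) * (1 - x ^ m k) =
      1 - x ^ ∑ k ∈ s, m k := by
  induction s using Finset.induction_on_min with
  | empty => simp
  | insert a s ha ih =>
    have ha' : a ∉ s := fun h => lt_irrefl _ (ha a h)
    have h1 : (insert a s).filter (fun j => a < j) = s := by
      ext j
      simp only [mem_filter, mem_insert]
      exact ⟨fun h => h.1.resolve_left h.2.ne', fun h => ⟨Or.inr h, ha j h⟩⟩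
    have h2 : ∀ k ∈ s, (insert a s).filter (fun j => k < j) = s.filter (fun j => k < j) := by
      intro k hk
      rw [filter_insert, if_neg (ha k hk).not_gt]
    have h3 : ∑ k ∈ s, x ^ (∑ j ∈ (insert a s).filter (fun j => k < j), m j) * (1 - x ^ m k) =
        1 - x ^ ∑ k ∈ s, m k := by
      rw [← ih]
      exact sum_congr rfl fun k hk => by rw [h2 k hk]
    rw [sum_insert ha', sum_insert ha', h1, h3, pow_add]
    ring

theorem exists_eq_add_single {n : ℕ} {m : Fin n → ℕ} {i : Fin n} (h : m i ≠ 0) :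
    ∃ m' : Fin n → ℕ, m = m' + Pi.single i 1 := by
  refine ⟨m - Pi.single i 1, ?_⟩
  ext k
  rcases eq_or_ne k i with rfl | hk
  · simp; omega
  · simp [hk]

theorem one_sub_mul_pow_ne_zero {q t : ℝ} (hq0 : 0 < q) (hq1 : q < 1) (ht0 : 0 < t) (ht1 : t < 1)
    (N : ℕ) : (1 : ℂ) - t * (q : ℂ) ^ N ≠ 0 := by
  have h : t * q ^ N < 1 :=
    (mul_le_of_le_one_right ht0.le (pow_le_one₀ hq0.le hq1.le)).trans_lt ht1
  have h' : (1 : ℝ) - t * q ^ N ≠ 0 := by linarith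
  exact_mod_cast h'


/-- Proposition 3.5: the defining relations of the two-parameter deformed polynomial
algebra of Toeplitz operators. `V` is the complex vector space with basis
`{e_m : m ∈ ℤ_{≥0}^n}` (realized as finitely supported functions), and `ẑ_i`, `ẑ*_i`
are the linear operators defined on the basis by
`ẑ_i e_m = q^{m_{i+1}+…+m_n} e_{m+ε_i}` and
`ẑ*_i e_m = q^{m_{i+1}+…+m_n} (1 − q^{2m_i})/(1 − t q^{2|m|+2n}) e_{m−ε_i}`
(the latter interpreted as `0` when `m_i = 0`). -/
theorem statement17 (q t : ℝ) (hq0 : 0 < q) (hq1 : q < 1) (ht0 : 0 < t) (ht1 : t < 1)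
    (n : ℕ) (hn : 1 ≤ n)
    (zh zs : Fin n → Module.End ℂ ((Fin n → ℕ) →₀ ℂ))
    (hzh : ∀ (i : Fin n) (m : Fin n → ℕ),
      zh i (Finsupp.single m 1) =
        ((q : ℂ) ^ (∑ j ∈ Finset.univ.filter (fun j => i < j), m j)) •
          Finsupp.single (m + Pi.single i 1) 1)
    (hzs : ∀ (i : Fin n) (m : Fin n → ℕ),
      zs i (Finsupp.single m 1) =
        ((q : ℂ) ^ (∑ j ∈ Finset.univ.filter (fun j => i < j), m j) *
            (1 - (q : ℂ) ^ (2 * m i)) /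
            (1 - (t : ℂ) * (q : ℂ) ^ (2 * (∑ j, m j) + 2 * n))) •
          Finsupp.single (m - Pi.single i 1) 1) :
    (∀ i j : Fin n, i < j → zh i * zh j = (q : ℂ) • (zh j * zh i)) ∧
    (∀ i j : Fin n, i ≠ j →
      zs i * zh j = (q : ℂ) • (zh j * zs i) +
        ((t : ℂ) * (q : ℂ) ^ (2 * n)) •
          (zs i * zh j *
              (((q : ℂ) ^ 2) • (1 : Module.End ℂ ((Fin n → ℕ) →₀ ℂ)) +
                ((1 : ℂ) - (q : ℂ) ^ 2) • ∑ k : Fin n, zh k * zs k) -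
            (q : ℂ) • (zh j * zs i))) ∧
    (∀ j : Fin n,
      zs j * zh j = ((q : ℂ) ^ 2) • (zh j * zs j) +
        ((1 : ℂ) - (q : ℂ) ^ 2) •
          ((1 : Module.End ℂ ((Fin n → ℕ) →₀ ℂ)) -
            ∑ k ∈ Finset.univ.filter (fun k => j < k), zh k * zs k) +
        ((t : ℂ) * (q : ℂ) ^ (2 * n)) •
          (zs j * zh j *
              (((q : ℂ) ^ 2) • (1 : Module.End ℂ ((Fin n → ℕ) →₀ ℂ)) +
                ((1 : ℂ) - (q : ℂ) ^ 2) • ∑ k : Fin n, zh k * zs k) -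
            ((q : ℂ) ^ 2) • (zh j * zs j) -
            ((1 : ℂ) - (q : ℂ) ^ 2) •
              ∑ k ∈ Finset.univ.filter (fun k => k ≤ j), zh k * zs k)) := by
  have hD : ∀ N : ℕ, (1 : ℂ) - t * (q : ℂ) ^ N ≠ 0 := one_sub_mul_pow_ne_zero hq0 hq1 ht0 ht1
  set Q : ℂ := (q : ℂ)
  set T : ℂ := (t : ℂ)
  have hzs_add : ∀ (i : Fin n) (m : Fin n → ℕ),
      zs i (Finsupp.single (m + Pi.single i 1) 1) =
        (Q ^ (∑ j ∈ Finset.univ.filter (fun j => i < j), m j) * (1 - Q ^ (2 * (m i + 1))) /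
          (1 - T * Q ^ (2 * (∑ j, m j + 1) + 2 * n))) • Finsupp.single m 1 := by
    intro i m
    rw [hzs, sum_filter_lt_add_single, sum_add_single]
    simp
  have hzs_zero : ∀ (i : Fin n) (m : Fin n → ℕ), m i = 0 → zs i (Finsupp.single m 1) = 0 := by
    intro i m h
    rw [hzs, h]
    simp
  have hdiag : ∀ (k : Fin n) (m : Fin n → ℕ),
      zh k (zs k (Finsupp.single m 1)) =
        ((Q ^ 2) ^ (∑ j ∈ Finset.univ.filter (fun j => k < j), m j) * (1 - (Q ^ 2) ^ m k) /
          (1 - T * Q ^ (2 * (∑ j, m j) + 2 * n))) • Finsupp.single m 1 := by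
    intro k m
    by_cases h : m k = 0
    · rw [hzs_zero k m h, h]
      simp
    · obtain ⟨m, rfl⟩ := exists_eq_add_single h
      rw [hzs_add, map_smul, hzh, smul_smul, sum_filter_lt_add_single, sum_add_single]
      congr 1
      simp only [lt_self_iff_false, if_false, Pi.add_apply, Pi.single_eq_same]
      ring
  have hsum : ∀ (s : Finset (Fin n)) (m : Fin n → ℕ),
      (∀ k ∈ s, ∀ j, k < j → j ∈ s) →
      (∑ k ∈ s, zh k * zs k) (Finsupp.single m 1) =
        ((1 - (Q ^ 2) ^ ∑ k ∈ s, m k) / (1 - T * Q ^ (2 * (∑ j, m j) + 2 * n))) •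
          Finsupp.single m 1 := by
    intro s m hs
    rw [← sum_pow_mul_one_sub_pow, Finset.sum_div, Finset.sum_smul, LinearMap.sum_apply]
    refine Finset.sum_congr rfl fun k hk => ?_
    have hf : s.filter (fun j => k < j) = Finset.univ.filter (fun j => k < j) := by
      ext j
      simpa using hs k hk j
    rw [Module.End.mul_apply, hdiag, hf]
  have hall : ∀ m : Fin n → ℕ, (∑ k, zh k * zs k) (Finsupp.single m 1) =
      ((1 - (Q ^ 2) ^ ∑ k, m k) / (1 - T * Q ^ (2 * (∑ j, m j) + 2 * n))) •
        Finsupp.single m 1 := fun m => hsum _ m (by simp)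
  have hgt : ∀ (j : Fin n) (m : Fin n → ℕ),
      (∑ k ∈ Finset.univ.filter (fun k => j < k), zh k * zs k) (Finsupp.single m 1) =
        ((1 - (Q ^ 2) ^ ∑ k ∈ Finset.univ.filter (fun k => j < k), m k) /
          (1 - T * Q ^ (2 * (∑ j, m j) + 2 * n))) • Finsupp.single m 1 :=
    fun j m => hsum _ m (by simpa using fun k hk l hl => hk.trans hl)
  have hle : ∀ j : Fin n, ∑ k ∈ Finset.univ.filter (fun k => k ≤ j), zh k * zs k =
      ∑ k, zh k * zs k - ∑ k ∈ Finset.univ.filter (fun k => j < k), zh k * zs k := by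
    intro j
    have h := Finset.sum_filter_add_sum_filter_not Finset.univ (fun k => k ≤ j)
      (fun k => zh k * zs k)
    simp only [not_le] at h
    rw [← h]
    abel
  refine ⟨fun i j hij => ?_, fun i j hij => ?_, fun j => ?_⟩
  all_goals
    refine Finsupp.lhom_ext' fun m => LinearMap.ext_ring ?_
    simp only [LinearMap.comp_apply, Finsupp.lsingle_apply]
  · simp only [Module.End.mul_apply, LinearMap.smul_apply, hzh, map_smul, smul_smul,
      sum_filter_lt_add_single, hij, hij.not_gt, if_true, if_false, add_right_comm m]
    congr 1
    ring
  · simp only [Module.End.mul_apply, LinearMap.smul_apply, LinearMap.add_apply,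
      LinearMap.sub_apply, Module.End.one_apply, hall, map_add, map_smul, hzh]
    by_cases h : m i = 0
    · rw [hzs_zero i m h, hzs_zero i _ (by simp [h, hij])]
      simp
    · obtain ⟨m, rfl⟩ := exists_eq_add_single h
      rw [add_right_comm m, hzs_add, hzs_add, map_smul, hzh]
      have hm : (m + Pi.single j 1 : Fin n → ℕ) i = m i := by simp [hij]
      simp only [smul_smul, ← add_smul, ← sub_smul, sum_filter_lt_add_single, sum_add_single, hm]
      congr 1
      have h1 := hD (2 * (∑ j, m j + 1) + 2 * n)
      have h2 := hD (2 * (∑ j, m j + 1 + 1) + 2 * n)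
      generalize ∑ j, m j = M at *
      rcases hij.lt_or_gt with h | h <;>
      · simp only [h, h.not_gt, if_true, if_false]
        field_simp
        ring
  · simp only [hle, Module.End.mul_apply, LinearMap.smul_apply, LinearMap.add_apply,
      LinearMap.sub_apply, Module.End.one_apply, hall, hgt, hdiag, map_add, map_smul, hzh, hzs_add]
    have h1 := hD (2 * (∑ j, m j) + 2 * n)
    have h2 := hD (2 * (∑ j, m j + 1) + 2 * n)
    match_scalars
    generalize ∑ j, m j = M at *
    field_simp
    ring
end
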